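/- For random variables X valued in 𝕏 and Y valued in 𝕐, if X and Y are independent then the averaged conditional Wasserstein distance D_{|•}(X,Y) = (E_X[W_{d_𝕐,p}(L(Y|X), L(Y))^p])^{1/p} equals zero, and conversely if D_{|•}(X,Y) = 0 then X and Y are independent. -/

import Mathlib

open MeasureTheory ProbabilityTheory

/-- The Wasserstein distance of order `p` with ground cost `d`, defined as the infimum
over couplings of `P` and `Q` of the `p`-th root of the expected `p`-th power cost. -/
noncomputable def Wass {α : Type*} [MeasurableSpace α]
    (d : α → α → ℝ) (p : ℝ) (P Q : Measure α) : ℝ :=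
  sInf ((fun γ : Measure (α × α) => (∫ z, d z.1 z.2 ^ p ∂γ) ^ (1 / p)) ''
    {γ | γ.map Prod.fst = P ∧ γ.map Prod.snd = Q})

open Filter Topology Set
open scoped ENNReal NNReal

section Wasserstein

variable {𝕐 : Type*} [MeasurableSpace 𝕐]

/-- The set of couplings of `P` and `Q`. -/
def couplings (P Q : Measure 𝕐) : Set (Measure (𝕐 × 𝕐)) :=
  {γ | γ.map Prod.fst = P ∧ γ.map Prod.snd = Q}

variable {P Q R : Measure 𝕐} {γ : Measure (𝕐 × 𝕐)}

lemma prod_mem_couplings [IsProbabilityMeasure P] [IsProbabilityMeasure Q] :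
    P.prod Q ∈ couplings P Q := by
  simp [couplings]

lemma isProbabilityMeasure_of_mem_couplings [IsProbabilityMeasure P] (hγ : γ ∈ couplings P Q) :
    IsProbabilityMeasure γ := by
  have : IsProbabilityMeasure (γ.map Prod.fst) := by rw [hγ.1]; infer_instance
  exact Measure.isProbabilityMeasure_of_map Prod.fst

lemma swap_mem_couplings (hγ : γ ∈ couplings P Q) : γ.map Prod.swap ∈ couplings Q P := by
  refine ⟨?_, ?_⟩
  · rw [Measure.map_map measurable_fst measurable_swap]; exact hγ.2
  · rw [Measure.map_map measurable_snd measurable_swap]; exact hγ.1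

lemma exists_gluing [StandardBorelSpace 𝕐] [Nonempty 𝕐] {γ₁ γ₂ : Measure (𝕐 × 𝕐)}
    [IsProbabilityMeasure γ₁] [IsProbabilityMeasure γ₂]
    (h : γ₁.map Prod.snd = γ₂.map Prod.fst) :
    ∃ η : Measure ((𝕐 × 𝕐) × 𝕐), η.map Prod.fst = γ₁ ∧
      η.map (fun z => (z.1.2, z.2)) = γ₂ := by
  have hm : Measurable fun z : (𝕐 × 𝕐) × 𝕐 => (z.1.2, z.2) := by fun_prop
  refine ⟨γ₁ ⊗ₘ (γ₂.condKernel.prodMkLeft 𝕐), Measure.fst_compProd _ _, ?_⟩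
  ext s hs
  conv_rhs => rw [← γ₂.disintegrate γ₂.condKernel, Measure.compProd_apply hs, Measure.fst, ← h]
  rw [Measure.map_apply hm hs, Measure.compProd_apply (hm hs),
    lintegral_map (Kernel.measurable_kernel_prodMk_left hs) measurable_snd]
  rfl

lemma map_simpleFunc_eq_sum_dirac [IsFiniteMeasure P] (T : SimpleFunc 𝕐 𝕐) :
    P.map T = ∑ i : T.range, (P (T ⁻¹' {i.1})).toNNReal • Measure.dirac i.1 := by
  ext s hs
  rw [Measure.map_apply T.measurable hs, Measure.finsetSum_apply]
  simp only [Measure.smul_apply, ENNReal.smul_def, ENNReal.coe_toNNReal (measure_ne_top _ _),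
    Measure.dirac_apply' _ hs, smul_eq_mul]
  classical
  rw [Finset.sum_coe_sort T.range fun i => P (T ⁻¹' {i}) * s.indicator 1 i]
  simp only [Set.indicator_apply, Pi.one_apply, mul_ite, mul_one, mul_zero]
  rw [← Finset.sum_filter, T.sum_measure_preimage_singleton]
  congr 1
  ext y
  simp

variable [MetricSpace 𝕐]

/-- The `L^p` transport cost of a plan `γ`. -/
noncomputable def transportCost (p : ℝ) (γ : Measure (𝕐 × 𝕐)) : ℝ :=
  (∫ z, dist z.1 z.2 ^ p ∂γ) ^ (1 / p)

/-- Finiteness of the `p`-th moment of `P`. -/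
def HasMoment (p : ℝ) (y₀ : 𝕐) (P : Measure 𝕐) : Prop :=
  Integrable (fun y => dist y y₀ ^ p) P

variable {p : ℝ} {y₀ : 𝕐}

lemma transportCost_nonneg : 0 ≤ transportCost p γ :=
  Real.rpow_nonneg (integral_nonneg fun _ => Real.rpow_nonneg dist_nonneg _) _

lemma wass_le_transportCost (hγ : γ ∈ couplings P Q) :
    Wass (fun y y' => dist y y') p P Q ≤ transportCost p γ :=
  csInf_le ⟨0, by rintro _ ⟨η, -, rfl⟩; exact transportCost_nonneg⟩ ⟨γ, hγ, rfl⟩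

lemma le_wass [IsProbabilityMeasure P] [IsProbabilityMeasure Q] {c : ℝ}
    (h : ∀ γ ∈ couplings P Q, c ≤ transportCost p γ) :
    c ≤ Wass (fun y y' => dist y y') p P Q := by
  refine le_csInf ⟨_, P.prod Q, prod_mem_couplings, rfl⟩ ?_
  rintro _ ⟨η, hη, rfl⟩
  exact h η hη

lemma wass_nonneg [IsProbabilityMeasure P] [IsProbabilityMeasure Q] :
    0 ≤ Wass (fun y y' => dist y y') p P Q :=
  le_wass fun _ _ => transportCost_nonneg

lemma HasMoment.add (hP : HasMoment p y₀ P) (hQ : HasMoment p y₀ Q) : HasMoment p y₀ (P + Q) :=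
  Integrable.add_measure hP hQ

lemma HasMoment.smul (hP : HasMoment p y₀ P) (c : ℝ≥0) : HasMoment p y₀ (c • P) :=
  Integrable.smul_measure_nnreal hP

lemma hasMoment_sum {ι : Type*} {s : Finset ι} {ν : ι → Measure 𝕐}
    (h : ∀ i ∈ s, HasMoment p y₀ (ν i)) : HasMoment p y₀ (∑ i ∈ s, ν i) :=
  integrable_finsetSum_measure.2 h

lemma wass_rpow_le [IsProbabilityMeasure P] [IsProbabilityMeasure Q] (hp : 1 ≤ p)
    (hP : HasMoment p y₀ P) (hQ : HasMoment p y₀ Q) :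
    Wass (fun y y' => dist y y') p P Q ^ p ≤
      2 ^ (p - 1) * ((∫ y, dist y y₀ ^ p ∂P) + (∫ y, dist y y₀ ^ p ∂Q)) := by
  have hp0 : 0 < p := by linarith
  have hi₁ : Integrable (fun z : 𝕐 × 𝕐 => dist z.1 y₀ ^ p) (P.prod Q) :=
    Integrable.comp_fst hP Q
  have hi₂ : Integrable (fun z : 𝕐 × 𝕐 => dist z.2 y₀ ^ p) (P.prod Q) :=
    Integrable.comp_snd hQ P
  have hle := Real.rpow_le_rpow wass_nonneg
    (wass_le_transportCost (p := p) (prod_mem_couplings (P := P) (Q := Q))) hp0.le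
  refine hle.trans ?_
  rw [transportCost, ← Real.rpow_mul
    (integral_nonneg fun _ => Real.rpow_nonneg dist_nonneg _), one_div_mul_cancel hp0.ne',
    Real.rpow_one]
  calc ∫ z, dist z.1 z.2 ^ p ∂(P.prod Q)
      ≤ ∫ z, 2 ^ (p - 1) * (dist z.1 y₀ ^ p + dist z.2 y₀ ^ p) ∂(P.prod Q) := by
        refine integral_mono_of_nonneg (ae_of_all _ fun _ => Real.rpow_nonneg dist_nonneg _)
          ((hi₁.add hi₂).const_mul _) (ae_of_all _ fun z => ?_)
        exact (Real.rpow_le_rpow dist_nonneg (dist_triangle_right _ _ y₀) hp0.le).trans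
          (by
            exact_mod_cast NNReal.rpow_add_le_mul_rpow_add_rpow (nndist z.1 y₀) (nndist z.2 y₀) hp)
    _ = 2 ^ (p - 1) * ((∫ y, dist y y₀ ^ p ∂P) + (∫ y, dist y y₀ ^ p ∂Q)) := by
        rw [integral_const_mul, integral_add hi₁ hi₂,
          integral_fun_fst (fun y => dist y y₀ ^ p), integral_fun_snd (fun y => dist y y₀ ^ p)]
        simp

variable [BorelSpace 𝕐] [SecondCountableTopology 𝕐]

lemma transportCost_eq_toReal_eLpNorm (hp : 1 ≤ p) :
    transportCost p γ = (eLpNorm (fun z => dist z.1 z.2) (ENNReal.ofReal p) γ).toReal := by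
  have hp0 : 0 < p := by linarith
  have hm : Measurable fun z : 𝕐 × 𝕐 => dist z.1 z.2 := by fun_prop
  rw [transportCost, eLpNorm_eq_lintegral_rpow_enorm_toReal (by simpa using hp0) (by simp),
    integral_eq_lintegral_of_nonneg_ae (ae_of_all _ fun _ => Real.rpow_nonneg dist_nonneg _)
      (hm.pow_const _).aestronglyMeasurable, ENNReal.toReal_rpow, ENNReal.toReal_ofReal hp0.le]
  congr! 4 with z
  rw [Real.enorm_of_nonneg dist_nonneg, ENNReal.ofReal_rpow_of_nonneg dist_nonneg hp0.le]

lemma transportCost_swap : transportCost p (γ.map Prod.swap) = transportCost p γ := by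
  have hm : Measurable fun z : 𝕐 × 𝕐 => dist z.1 z.2 := by fun_prop
  rw [transportCost, integral_map measurable_swap.aemeasurable
    (hm.pow_const _).aestronglyMeasurable]
  simp [transportCost, dist_comm]

lemma hasMoment_iff_memLp (hp : 1 ≤ p) :
    HasMoment p y₀ P ↔ MemLp (fun y => dist y y₀) (ENNReal.ofReal p) P := by
  have hp0 : 0 < p := by linarith
  have hm : Measurable fun y => dist y y₀ := by fun_prop
  rw [← integrable_norm_rpow_iff hm.aestronglyMeasurable (by simpa using hp0) (by simp),
    ENNReal.toReal_ofReal hp0.le]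
  simp [HasMoment, abs_of_nonneg dist_nonneg]

lemma memLp_dist_of_mem_couplings (hp : 1 ≤ p) (hP : HasMoment p y₀ P) (hQ : HasMoment p y₀ Q)
    (hγ : γ ∈ couplings P Q) :
    MemLp (fun z => dist z.1 z.2) (ENNReal.ofReal p) γ := by
  have hm : Measurable fun z : 𝕐 × 𝕐 => dist z.1 z.2 := by fun_prop
  rw [hasMoment_iff_memLp hp] at hP hQ
  have h1 : MemLp (fun z => dist (Prod.fst z) y₀) (ENNReal.ofReal p) γ :=
    (hγ.1 ▸ hP).comp_of_map measurable_fst.aemeasurable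
  have h2 : MemLp (fun z => dist (Prod.snd z) y₀) (ENNReal.ofReal p) γ :=
    (hγ.2 ▸ hQ).comp_of_map measurable_snd.aemeasurable
  refine (h1.add h2).mono' hm.aestronglyMeasurable (ae_of_all _ fun z => ?_)
  simpa [abs_of_nonneg dist_nonneg] using dist_triangle_right z.1 z.2 y₀

lemma exists_coupling_eLpNorm_le_add [StandardBorelSpace 𝕐] [Nonempty 𝕐]
    {γ₁ γ₂ : Measure (𝕐 × 𝕐)} [IsProbabilityMeasure γ₁] [IsProbabilityMeasure γ₂]
    (h₁ : γ₁ ∈ couplings P Q) (h₂ : γ₂ ∈ couplings Q R) {q : ℝ≥0∞} (hq : 1 ≤ q) :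
    ∃ γ ∈ couplings P R, eLpNorm (fun z => dist z.1 z.2) q γ ≤
      eLpNorm (fun z => dist z.1 z.2) q γ₁ + eLpNorm (fun z => dist z.1 z.2) q γ₂ := by
  obtain ⟨η, rfl, rfl⟩ := exists_gluing (h₁.2.trans h₂.1.symm)
  have hm : Measurable fun z : 𝕐 × 𝕐 => dist z.1 z.2 := measurable_dist
  have hm₂ : Measurable fun z : (𝕐 × 𝕐) × 𝕐 => (z.1.2, z.2) := by fun_prop
  have hm₃ : Measurable fun z : (𝕐 × 𝕐) × 𝕐 => (z.1.1, z.2) := by fun_prop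
  refine ⟨η.map fun z => (z.1.1, z.2), ⟨?_, ?_⟩, ?_⟩
  · rw [← h₁.1, Measure.map_map measurable_fst hm₃, Measure.map_map measurable_fst measurable_fst]
    rfl
  · rw [← h₂.2, Measure.map_map measurable_snd hm₃, Measure.map_map measurable_snd hm₂]
    rfl
  · rw [eLpNorm_map_measure hm.aestronglyMeasurable hm₃.aemeasurable,
      eLpNorm_map_measure hm.aestronglyMeasurable hm₂.aemeasurable,
      eLpNorm_map_measure hm.aestronglyMeasurable measurable_fst.aemeasurable]
    refine le_trans (eLpNorm_mono_real fun z => ?_)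
      (eLpNorm_add_le (hm.comp measurable_fst).aestronglyMeasurable
        (hm.comp hm₂).aestronglyMeasurable hq)
    simpa only [Function.comp_apply, Pi.add_apply, Real.norm_of_nonneg dist_nonneg]
      using dist_triangle z.1.1 z.1.2 z.2

lemma wass_triangle [StandardBorelSpace 𝕐] [IsProbabilityMeasure P] [IsProbabilityMeasure Q]
    [IsProbabilityMeasure R] (hp : 1 ≤ p)
    (hP : HasMoment p y₀ P) (hQ : HasMoment p y₀ Q) (hR : HasMoment p y₀ R) :
    Wass (fun y y' => dist y y') p P R ≤
      Wass (fun y y' => dist y y') p P Q + Wass (fun y y' => dist y y') p Q R := by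
  have : Nonempty 𝕐 := ⟨y₀⟩
  rw [← sub_le_iff_le_add']
  refine le_wass fun γ₂ h₂ => ?_
  rw [sub_le_comm]
  refine le_wass fun γ₁ h₁ => ?_
  rw [sub_le_iff_le_add]
  have := isProbabilityMeasure_of_mem_couplings h₁
  have := isProbabilityMeasure_of_mem_couplings h₂
  obtain ⟨γ, hγ, hle⟩ :=
    exists_coupling_eLpNorm_le_add h₁ h₂ (q := ENNReal.ofReal p) (by simpa using hp)
  refine (wass_le_transportCost hγ).trans ?_
  have m₁ := memLp_dist_of_mem_couplings hp hP hQ h₁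
  have m₂ := memLp_dist_of_mem_couplings hp hQ hR h₂
  simp only [transportCost_eq_toReal_eLpNorm hp]
  rw [← ENNReal.toReal_add m₁.2.ne m₂.2.ne]
  exact ENNReal.toReal_mono (ENNReal.add_ne_top.2 ⟨m₁.2.ne, m₂.2.ne⟩) hle

lemma abs_wass_sub_wass_le [StandardBorelSpace 𝕐] [IsProbabilityMeasure P]
    [IsProbabilityMeasure Q] [IsProbabilityMeasure R] (hp : 1 ≤ p)
    (hP : HasMoment p y₀ P) (hQ : HasMoment p y₀ Q) (hR : HasMoment p y₀ R)
    (hγ : γ ∈ couplings P Q) :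
    |Wass (fun y y' => dist y y') p P R - Wass (fun y y' => dist y y') p Q R| ≤
      transportCost p γ := by
  rw [abs_sub_le_iff]
  have h₁ := wass_triangle hp hP hQ hR
  have h₂ := wass_triangle hp hQ hP hR
  have h₃ := wass_le_transportCost (p := p) hγ
  have h₄ := wass_le_transportCost (p := p) (swap_mem_couplings hγ)
  rw [transportCost_swap] at h₄
  constructor <;> linarith

lemma measure_closed_le_of_wass_eq_zero [IsProbabilityMeasure P] [IsProbabilityMeasure Q]
    (hp : 1 ≤ p) (hP : HasMoment p y₀ P) (hQ : HasMoment p y₀ Q)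
    (h : ∀ ε > 0, ∃ γ ∈ couplings P Q, transportCost p γ < ε) {F : Set 𝕐} (hF : IsClosed F) :
    P F ≤ Q F := by
  have hm : Measurable fun z : 𝕐 × 𝕐 => dist z.1 z.2 := by fun_prop
  refine ge_of_tendsto (tendsto_measure_thickening_of_isClosed ⟨1, one_pos, by simp⟩ hF)
    (eventually_mem_nhdsWithin.mono fun δ (hδ : 0 < δ) => ?_)
  refine ENNReal.le_of_forall_pos_le_add fun ε hε _ => ?_
  obtain ⟨γ, hγ, hc⟩ := h (δ * ε) (by positivity)
  have := isProbabilityMeasure_of_mem_couplings hγ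
  have mγ := memLp_dist_of_mem_couplings hp hP hQ hγ
  have i1 : Integrable (fun z => dist z.1 z.2) γ := mγ.integrable (by simpa using hp)
  have hcost : ∫ z, dist z.1 z.2 ∂γ ≤ transportCost p γ := by
    rw [transportCost_eq_toReal_eLpNorm hp]
    have h1 : eLpNorm (fun z : 𝕐 × 𝕐 => dist z.1 z.2) 1 γ ≤ _ :=
      eLpNorm_le_eLpNorm_of_exponent_le (q := ENNReal.ofReal p) (by simpa using hp)
        hm.aestronglyMeasurable
    refine le_trans (le_of_eq ?_) (ENNReal.toReal_mono mγ.2.ne h1)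
    rw [integral_eq_lintegral_of_nonneg_ae (ae_of_all _ fun _ => dist_nonneg)
      hm.aestronglyMeasurable, eLpNorm_one_eq_lintegral_enorm]
    simp only [Real.enorm_of_nonneg dist_nonneg]
  have hmk := mul_meas_ge_le_integral_of_nonneg (ae_of_all γ fun z => dist_nonneg) i1 δ
  have hbad : γ {z | δ ≤ dist z.1 z.2} ≤ ε := by
    rw [← ENNReal.ofReal_coe_nnreal, ← ofReal_measureReal]
    refine ENNReal.ofReal_le_ofReal ?_
    exact le_of_mul_le_mul_left (by linarith) hδ
  calc P F = γ (Prod.fst ⁻¹' F) := by rw [← hγ.1, Measure.map_apply measurable_fst hF.measurableSet]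
    _ ≤ γ (Prod.snd ⁻¹' Metric.thickening δ F ∪ {z | δ ≤ dist z.1 z.2}) := by
        refine measure_mono fun z hz => ?_
        by_cases hd : δ ≤ dist z.1 z.2
        · exact Or.inr hd
        · exact Or.inl (Metric.mem_thickening_iff.2 ⟨z.1, hz, by rw [dist_comm]; linarith⟩)
    _ ≤ γ (Prod.snd ⁻¹' Metric.thickening δ F) + γ {z | δ ≤ dist z.1 z.2} := measure_union_le _ _
    _ ≤ Q (Metric.thickening δ F) + ε := by
        rw [← hγ.2, Measure.map_apply measurable_snd Metric.isOpen_thickening.measurableSet]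
        gcongr

lemma eq_of_wass_eq_zero [IsProbabilityMeasure P] [IsProbabilityMeasure Q]
    (hp : 1 ≤ p) (hP : HasMoment p y₀ P) (hQ : HasMoment p y₀ Q)
    (h : Wass (fun y y' => dist y y') p P Q = 0) : P = Q := by
  have key : ∀ ε > 0, ∃ γ ∈ couplings P Q, transportCost p γ < ε := by
    intro ε hε
    by_contra! hc
    have := le_wass hc
    linarith
  have key' : ∀ ε > 0, ∃ γ ∈ couplings Q P, transportCost p γ < ε := by
    intro ε hε
    obtain ⟨γ, hγ, hc⟩ := key ε hε
    exact ⟨_, swap_mem_couplings hγ, by rwa [transportCost_swap]⟩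
  refine ext_of_generate_finite _ (BorelSpace.measurable_eq.trans borel_eq_generateFrom_isClosed)
    isPiSystem_isClosed (fun F hF => ?_) (by simp)
  exact (measure_closed_le_of_wass_eq_zero hp hP hQ key hF).antisymm
    (measure_closed_le_of_wass_eq_zero hp hQ hP key' hF)

lemma wass_self [IsProbabilityMeasure P] (hp : 1 ≤ p) :
    Wass (fun y y' => dist y y') p P P = 0 := by
  have hm : Measurable fun z : 𝕐 × 𝕐 => dist z.1 z.2 := by fun_prop
  have hd : Measurable fun y : 𝕐 => (y, y) := by fun_prop
  have hp0 : p ≠ 0 := by linarith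
  refine le_antisymm ?_ wass_nonneg
  have hγ : P.map (fun y => (y, y)) ∈ couplings P P := by
    refine ⟨?_, ?_⟩
    · rw [Measure.map_map measurable_fst hd]; exact Measure.map_id
    · rw [Measure.map_map measurable_snd hd]; exact Measure.map_id
  refine (wass_le_transportCost hγ).trans_eq ?_
  rw [transportCost, integral_map hd.aemeasurable (hm.pow_const _).aestronglyMeasurable]
  simp [Real.zero_rpow hp0, Real.zero_rpow (inv_ne_zero hp0)]

lemma hasMoment_map_simpleFunc [IsProbabilityMeasure P] (T : SimpleFunc 𝕐 𝕐) :
    HasMoment p y₀ (P.map T) := by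
  have hm : Measurable fun y => dist y y₀ := by fun_prop
  rw [HasMoment, integrable_map_measure (hm.pow_const p).aestronglyMeasurable
    T.measurable.aemeasurable]
  exact (T.map fun y => dist y y₀ ^ p).integrable_of_isFiniteMeasure

lemma hasMoment_dirac (y : 𝕐) : HasMoment p y₀ (Measure.dirac y) :=
  integrable_dirac (by simp)

lemma tendsto_wass_map_approxOn [StandardBorelSpace 𝕐] [IsProbabilityMeasure P]
    [IsProbabilityMeasure R] (hp : 1 ≤ p) (hP : HasMoment p y₀ P) (hR : HasMoment p y₀ R) :
    Tendsto (fun n => Wass (fun y y' => dist y y') p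
      (P.map (SimpleFunc.approxOn id measurable_id univ y₀ (mem_univ _) n)) R) atTop
      (𝓝 (Wass (fun y y' => dist y y') p P R)) := by
  have hp0 : 0 < p := by linarith
  set T := SimpleFunc.approxOn id measurable_id univ y₀ (mem_univ _) with hT
  have hm : Measurable fun z : 𝕐 × 𝕐 => dist z.1 z.2 := measurable_dist
  have hg (n) : Measurable fun y => (T n y, y) := (T n).measurable.prodMk measurable_id
  have hγ (n) : P.map (fun y => (T n y, y)) ∈ couplings (P.map (T n)) P := by
    refine ⟨?_, ?_⟩
    · rw [Measure.map_map measurable_fst (hg n)]; rfl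
    · rw [Measure.map_map measurable_snd (hg n)]; exact Measure.map_id
  have hc (n) : transportCost p (P.map fun y => (T n y, y)) =
      (∫ y, dist (T n y) y ^ p ∂P) ^ (1 / p) := by
    rw [transportCost, integral_map (hg n).aemeasurable (hm.pow_const _).aestronglyMeasurable]
  have hlim : Tendsto (fun n => ∫ y, dist (T n y) y ^ p ∂P) atTop (𝓝 (∫ _, 0 ∂P)) := by
    refine tendsto_integral_of_dominated_convergence (fun y => dist y y₀ ^ p)
      (fun n => ((hm.comp (hg n)).pow_const p).aestronglyMeasurable) hP
      (fun n => ae_of_all _ fun y => ?_) (ae_of_all _ fun y => ?_)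
    · rw [Real.norm_of_nonneg (Real.rpow_nonneg dist_nonneg _)]
      refine Real.rpow_le_rpow dist_nonneg ?_ hp0.le
      have := SimpleFunc.edist_approxOn_le measurable_id (mem_univ y₀) y n
      rwa [edist_dist, edist_dist, ENNReal.ofReal_le_ofReal_iff dist_nonneg, dist_comm y₀] at this
    · have h1 : Tendsto (fun n => T n y) atTop (𝓝 y) :=
        SimpleFunc.tendsto_approxOn measurable_id (mem_univ y₀) (by simp)
      have h2 := (h1.dist (tendsto_const_nhds (x := y))).rpow_const (p := p) (Or.inr hp0.le)
      simpa [Real.zero_rpow hp0.ne'] using h2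
  have hlim' := hlim.rpow_const (p := 1 / p) (Or.inr (by positivity))
  rw [integral_zero, Real.zero_rpow (by positivity)] at hlim'
  rw [tendsto_iff_dist_tendsto_zero]
  refine squeeze_zero (fun _ => dist_nonneg) (fun n => ?_) hlim'
  have := Measure.isProbabilityMeasure_map (μ := P) (T n).measurable.aemeasurable
  rw [Real.dist_eq, ← hc]
  exact abs_wass_sub_wass_le hp (hasMoment_map_simpleFunc _) hP hR (hγ n)

lemma abs_wass_sum_dirac_sub_le [StandardBorelSpace 𝕐] [IsProbabilityMeasure R] (hp : 1 ≤ p)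
    (hR : HasMoment p y₀ R) {ι : Type*} [Fintype ι] (z : ι → 𝕐) {a w : ι → ℝ≥0} (ha : a ≤ w)
    (hw : ∑ i, w i = 1) :
    |Wass (fun y y' => dist y y') p (∑ i, w i • Measure.dirac (z i)) R -
      Wass (fun y y' => dist y y') p
        (∑ i, a i • Measure.dirac (z i) + (1 - ∑ i, a i) • Measure.dirac y₀) R| ≤
      (∑ i, ((w i : ℝ) - a i) * dist (z i) y₀ ^ p) ^ (1 / p) := by
  have hp0 : 0 < p := by linarith
  have hsum : ∑ i, a i + ∑ i, (w i - a i) = 1 := by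
    rw [← Finset.sum_add_distrib, ← hw]
    exact Finset.sum_congr rfl fun i _ => add_tsub_cancel_of_le (ha i)
  have hsub : 1 - ∑ i, a i = ∑ i, (w i - a i) := by
    rw [← hsum, add_tsub_cancel_left]
  have hP : IsProbabilityMeasure (∑ i, w i • Measure.dirac (z i)) := ⟨by
    simp only [Measure.finsetSum_apply, Measure.smul_apply, measure_univ, ENNReal.smul_def,
      smul_eq_mul, mul_one]
    exact_mod_cast hw⟩
  have hQ : IsProbabilityMeasure
      (∑ i, a i • Measure.dirac (z i) + (1 - ∑ i, a i) • Measure.dirac y₀) := ⟨by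
    rw [hsub]
    simp only [Measure.add_apply, Measure.finsetSum_apply, Measure.smul_apply, measure_univ,
      ENNReal.smul_def, smul_eq_mul, mul_one]
    exact_mod_cast hsum⟩
  set γ : Measure (𝕐 × 𝕐) := ∑ i, (a i • Measure.dirac (z i, z i) +
    (w i - a i) • Measure.dirac (z i, y₀)) with hγdef
  have hmap {f : 𝕐 × 𝕐 → 𝕐} (hf : Measurable f) : γ.map f =
      ∑ i, (a i • Measure.dirac (f (z i, z i)) + (w i - a i) • Measure.dirac (f (z i, y₀))) := by
    rw [hγdef, ← Measure.mapₗ_apply_of_measurable hf, map_sum]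
    refine Finset.sum_congr rfl fun i _ => ?_
    rw [Measure.mapₗ_apply_of_measurable hf, Measure.map_add _ _ hf, Measure.map_smul,
      Measure.map_smul, Measure.map_dirac' hf, Measure.map_dirac' hf]
  have hγ : γ ∈ couplings (∑ i, w i • Measure.dirac (z i))
      (∑ i, a i • Measure.dirac (z i) + (1 - ∑ i, a i) • Measure.dirac y₀) := by
    refine ⟨?_, ?_⟩
    · rw [hmap measurable_fst]
      refine Finset.sum_congr rfl fun i _ => ?_
      rw [← add_smul, add_tsub_cancel_of_le (ha i)]
    · rw [hmap measurable_snd, Finset.sum_add_distrib, hsub, Finset.sum_smul]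
  have hc : transportCost p γ = (∑ i, ((w i : ℝ) - a i) * dist (z i) y₀ ^ p) ^ (1 / p) := by
    have hi (y : 𝕐 × 𝕐) (c : ℝ≥0) :
        Integrable (fun z : 𝕐 × 𝕐 => dist z.1 z.2 ^ p) (c • Measure.dirac y) :=
      (integrable_dirac (by simp)).smul_measure_nnreal
    rw [transportCost, hγdef, integral_finsetSum_measure fun i _ => (hi _ _).add_measure (hi _ _)]
    congr 1
    refine Finset.sum_congr rfl fun i _ => ?_
    rw [integral_add_measure (hi _ _) (hi _ _), integral_smul_nnreal_measure,
      integral_smul_nnreal_measure, integral_dirac, integral_dirac]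
    simp [Real.zero_rpow hp0.ne', NNReal.smul_def, NNReal.coe_sub (ha i)]
  rw [← hc]
  exact abs_wass_sub_wass_le hp (hasMoment_sum fun i _ => (hasMoment_dirac _).smul _)
    ((hasMoment_sum fun i _ => (hasMoment_dirac _).smul _).add ((hasMoment_dirac _).smul _)) hR hγ

lemma measurable_wass_sum_dirac [StandardBorelSpace 𝕐] [IsProbabilityMeasure R] (hp : 1 ≤ p)
    (hR : HasMoment p y₀ R) {𝕏 ι : Type*} [MeasurableSpace 𝕏] [Fintype ι] (z : ι → 𝕐)
    {w : 𝕏 → ι → ℝ≥0} (hw : ∀ i, Measurable fun x => w x i) (hw1 : ∀ x, ∑ i, w x i = 1) :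
    Measurable fun x => Wass (fun y y' => dist y y') p (∑ i, w x i • Measure.dirac (z i)) R := by
  have hp0 : 0 < p := by linarith
  let k (m : ℕ) (x : 𝕏) (i : ι) : ℕ := ⌊(w x i : ℝ) * m⌋₊
  let a (m : ℕ) (k : ι → ℕ) (i : ι) : ℝ≥0 := k i / m
  have ha (m x) : a m (k m x) ≤ w x := fun i => by
    rw [← NNReal.coe_le_coe]
    simp only [a, k, NNReal.coe_div, NNReal.coe_natCast]
    exact div_le_of_le_mul₀ (by positivity) (by positivity) (Nat.floor_le (by positivity))
  have hlim (x i) : Tendsto (fun m => (a m (k m x) i : ℝ)) atTop (𝓝 (w x i)) := by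
    simp only [a, k, NNReal.coe_div, NNReal.coe_natCast]
    exact (tendsto_nat_floor_mul_div_atTop (w x i).coe_nonneg).comp
      (tendsto_natCast_atTop_atTop (R := ℝ))
  refine measurable_of_tendsto_metrizable (f := fun m x => Wass (fun y y' => dist y y') p
    (∑ i, a m (k m x) i • Measure.dirac (z i) +
      (1 - ∑ i, a m (k m x) i) • Measure.dirac y₀) R) (fun m => ?_) (tendsto_pi_nhds.2 fun x => ?_)
  · have hk : Measurable (k m) := measurable_pi_lambda _ fun i =>
      Nat.measurable_floor.comp ((hw i).coe_nnreal_real.mul_const _)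
    exact (measurable_of_countable fun j : ι → ℕ => Wass (fun y y' => dist y y') p
      (∑ i, a m j i • Measure.dirac (z i) + (1 - ∑ i, a m j i) • Measure.dirac y₀) R).comp hk
  · rw [tendsto_iff_dist_tendsto_zero]
    have h0 : Tendsto (fun m => ∑ i, ((w x i : ℝ) - a m (k m x) i) * dist (z i) y₀ ^ p) atTop
        (𝓝 (∑ i, ((w x i : ℝ) - w x i) * dist (z i) y₀ ^ p)) :=
      tendsto_finsetSum _ fun i _ => ((hlim x i).const_sub _).mul_const _
    have h1 := h0.rpow_const (p := 1 / p) (Or.inr (by positivity))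
    simp only [sub_self, zero_mul, Finset.sum_const_zero] at h1
    rw [Real.zero_rpow (by positivity)] at h1
    refine squeeze_zero (fun _ => dist_nonneg) (fun m => ?_) h1
    rw [dist_comm, Real.dist_eq]
    exact abs_wass_sum_dirac_sub_le hp hR z (ha m x) (hw1 x)

lemma aemeasurable_wass_kernel [StandardBorelSpace 𝕐] [IsProbabilityMeasure R] (hp : 1 ≤ p)
    (hR : HasMoment p y₀ R) {𝕏 : Type*} [MeasurableSpace 𝕏] {ν : Measure 𝕏} (κ : Kernel 𝕏 𝕐)
    [IsMarkovKernel κ] (hκ : ∀ᵐ x ∂ν, HasMoment p y₀ (κ x)) :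
    AEMeasurable (fun x => Wass (fun y y' => dist y y') p (κ x) R) ν := by
  refine aemeasurable_of_tendsto_metrizable_ae' (fun n => Measurable.aemeasurable ?_)
    (hκ.mono fun x hx => tendsto_wass_map_approxOn hp hx hR)
  simp only [map_simpleFunc_eq_sum_dirac]
  set T := SimpleFunc.approxOn id measurable_id univ y₀ (mem_univ _) n
  refine measurable_wass_sum_dirac hp hR _
    (fun i => (κ.measurable_coe (T.measurableSet_preimage _)).ennreal_toNNReal) fun x => ?_
  rw [← ENNReal.coe_inj]
  simp only [ENNReal.ofNNReal_finsetSum, ENNReal.coe_toNNReal (measure_ne_top _ _), ENNReal.coe_one]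
  rw [Finset.sum_coe_sort T.range fun i => κ x (T ⁻¹' {i}),
    SimpleFunc.sum_range_measure_preimage_singleton, measure_univ]

end Wasserstein

lemma indepFun_iff_condDistrib_ae_eq {Ω 𝕏 𝕐 : Type*} [MeasurableSpace Ω] [MeasurableSpace 𝕏]
    [MeasurableSpace 𝕐] [StandardBorelSpace 𝕐] [Nonempty 𝕐] {μ : Measure Ω}
    [IsProbabilityMeasure μ] {X : Ω → 𝕏} {Y : Ω → 𝕐} (hX : Measurable X) (hY : Measurable Y) :
    IndepFun X Y μ ↔ ∀ᵐ x ∂(μ.map X), condDistrib Y X μ x = μ.map Y := by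
  have := Measure.isProbabilityMeasure_map (μ := μ) hX.aemeasurable
  have := Measure.isProbabilityMeasure_map (μ := μ) hY.aemeasurable
  rw [indepFun_iff_map_prod_eq_prod_map_map hX.aemeasurable hY.aemeasurable,
    ← Measure.compProd_const, ← condDistrib_ae_eq_iff_measure_eq_compProd X hY.aemeasurable]
  rfl

theorem stmt1 {Ω 𝕏 𝕐 : Type*} [MeasurableSpace Ω] [MeasurableSpace 𝕏]
    [MetricSpace 𝕐] [PolishSpace 𝕐] [MeasurableSpace 𝕐] [BorelSpace 𝕐] [Nonempty 𝕐]
    (μ : Measure Ω) [IsProbabilityMeasure μ]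
    (X : Ω → 𝕏) (Y : Ω → 𝕐) (hX : Measurable X) (hY : Measurable Y)
    (p : ℝ) (hp : 1 ≤ p) (y₀ : 𝕐)
    (hmY : Integrable (fun ω => dist (Y ω) y₀ ^ p) μ) :
    IndepFun X Y μ ↔
      (∫ x, Wass (fun y y' => dist y y') p (condDistrib Y X μ x) (μ.map Y) ^ p
          ∂(μ.map X)) ^ (1 / p) = 0 := by
  have hp0 : 0 < p := by linarith
  have hm : Measurable fun y => dist y y₀ ^ p := (by fun_prop : Measurable _).pow_const p
  have hPX := Measure.isProbabilityMeasure_map (μ := μ) hX.aemeasurable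
  have hPY := Measure.isProbabilityMeasure_map (μ := μ) hY.aemeasurable
  have hR : HasMoment p y₀ (μ.map Y) :=
    (integrable_map_measure hm.aestronglyMeasurable hY.aemeasurable).2 hmY
  have hjoint : Integrable (fun z : 𝕏 × 𝕐 => dist z.2 y₀ ^ p) (μ.map fun ω => (X ω, Y ω)) :=
    (integrable_map_measure (hm.comp measurable_snd).aestronglyMeasurable
      (hX.prodMk hY).aemeasurable).2 hmY
  have hκ : ∀ᵐ x ∂(μ.map X), HasMoment p y₀ (condDistrib Y X μ x) :=
    hjoint.condDistrib_ae_map hY.aemeasurable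
  have hint : Integrable (fun x => Wass (fun y y' => dist y y') p (condDistrib Y X μ x)
      (μ.map Y) ^ p) (μ.map X) := by
    refine Integrable.mono' (((hjoint.integral_condDistrib_map hY.aemeasurable).add
      (integrable_const (∫ y, dist y y₀ ^ p ∂(μ.map Y)))).const_mul (2 ^ (p - 1)))
      ((aemeasurable_wass_kernel hp hR _ hκ).pow_const p).aestronglyMeasurable
      (hκ.mono fun x hx => ?_)
    rw [Real.norm_of_nonneg (Real.rpow_nonneg wass_nonneg _)]
    exact wass_rpow_le hp hx hR
  have hnn : 0 ≤ fun x => Wass (fun y y' => dist y y') p (condDistrib Y X μ x) (μ.map Y) ^ p :=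
    fun x => Real.rpow_nonneg wass_nonneg _
  rw [indepFun_iff_condDistrib_ae_eq hX hY, Real.rpow_eq_zero (integral_nonneg hnn) (by positivity),
    integral_eq_zero_iff_of_nonneg hnn hint]
  constructor
  · refine fun h => h.mono fun x hx => ?_
    simp only [hx, wass_self hp, Real.zero_rpow hp0.ne', Pi.zero_apply]
  · intro h
    filter_upwards [h, hκ] with x hx hmx
    exact eq_of_wass_eq_zero hp hmx hR ((Real.rpow_eq_zero wass_nonneg hp0.ne').1 hx)
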